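/- Let 𝓑 ⊆ ℝ^{2×2} be a closed set and A ∈ ℝ^{2×2}. Let ν ∈ ℝ² be a unit vector, τ = ν⊥, x₀ ∈ ℝ², r > 0, and let g : ℝ → ℝ be Lipschitz with g(0) = 0, differentiable at 0 with g′(0) = 0. Define U₁ = {x₀ + tτ + hν : t, h ∈ ℝ, h < g(t)} ∩ B(x₀,r) and U₂ = {x₀ + tτ + hν : t, h ∈ ℝ, h > g(t)} ∩ B(x₀,r), where B(x₀,r) is the open ball in ℝ². Suppose u : B(x₀,r) → ℝ² is Lipschitz and differentiable almost everywhere with derivative D u(x) = A for almost every x ∈ U₁ and D u(x) ∈ 𝓑 for almost every x ∈ U₂. Then there exists a ∈ ℝ² such that A + a⊗ν belongs to the polyconvex hull 𝓑^{pc}. -/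

import Mathlib

open Matrix Real Set MeasureTheory

noncomputable section

/-- The space of real 2×2 matrices. -/
abbrev M2 : Type := Matrix (Fin 2) (Fin 2) ℝ

/-- Euclidean norm on ℝ². -/
def enorm2 (v : Fin 2 → ℝ) : ℝ := Real.sqrt ((v 0) ^ 2 + (v 1) ^ 2)

/-- Rotation matrix by angle θ. -/
def rot (θ : ℝ) : M2 := !![Real.cos θ, -Real.sin θ; Real.sin θ, Real.cos θ]

/-- The set of rotations SO(2). -/
def SO2 : Set M2 := {R : M2 | ∃ θ : ℝ, R = rot θ}

def e1 : Fin 2 → ℝ := ![1, 0]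
def e2 : Fin 2 → ℝ := ![0, 1]

/-- Perpendicular vector w⊥ = (−w₂, w₁). -/
def perp (w : Fin 2 → ℝ) : Fin 2 → ℝ := ![-(w 1), w 0]

/-- 𝓜_s = {F : det F = 1 and ‖F s‖ = 1}. -/
def calM (s : Fin 2 → ℝ) : Set M2 := {F : M2 | F.det = 1 ∧ enorm2 (F.mulVec s) = 1}

/-- 𝓝_s = {F : det F = 1 and ‖F s‖ ≤ 1}. -/
def calN (s : Fin 2 → ℝ) : Set M2 := {F : M2 | F.det = 1 ∧ enorm2 (F.mulVec s) ≤ 1}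

/-- The derivative of a map ℝ² → ℝ² at a point, as a 2×2 matrix. -/
def gradMatrix (u : (Fin 2 → ℝ) → Fin 2 → ℝ) (x : Fin 2 → ℝ) : M2 :=
  LinearMap.toMatrix' ((fderiv ℝ u x).toLinearMap)

/-- A function ℝ^{2×2} → ℝ is polyconvex if it is a convex function of (F, det F). -/
def Polyconvex (h : M2 → ℝ) : Prop :=
  ∃ g : M2 × ℝ → ℝ, ConvexOn ℝ Set.univ g ∧ ∀ F : M2, h F = g (F, F.det)

/-- The polyconvex hull of a set 𝓑 ⊆ ℝ^{2×2}. -/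
def pcHull (B : Set M2) : Set M2 :=
  {F : M2 | ∀ h : M2 → ℝ, Polyconvex h → ∀ c : ℝ, (∀ G ∈ B, h G ≤ c) → h F ≤ c}

open Matrix Real Set MeasureTheory
open scoped Topology NNReal ENNReal

abbrev E2 := ℝ × ℝ

theorem hc_lineDeriv_zero {f : E2 → ℝ} {x : E2} (v : E2) (hx : x ∉ tsupport f) :
    lineDeriv ℝ f x v = 0 := by
  have h : f =ᶠ[𝓝 x] 0 := notMem_tsupport_iff_eventuallyEq.1 hx
  have h2 : HasFDerivAt f (0 : E2 →L[ℝ] ℝ) x :=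
    (hasFDerivAt_const (0:ℝ) x).congr_of_eventuallyEq h
  simpa using (h2.hasLineDerivAt v).lineDeriv

theorem hc_integrable {f : E2 → ℝ} {C : ℝ≥0} (hf : LipschitzWith C f) (h'f : HasCompactSupport f)
    (v : E2) : Integrable (fun x => lineDeriv ℝ f x v) (volume : Measure E2) := by
  have h1 : IntegrableOn (fun x => lineDeriv ℝ f x v) (tsupport f) (volume : Measure E2) :=
    (hf.locallyIntegrable_lineDeriv v).integrableOn_isCompact h'f
  rw [← integrable_indicator_iff (isClosed_tsupport f).measurableSet] at h1
  refine h1.congr (Filter.Eventually.of_forall fun x => ?_)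
  by_cases hx : x ∈ tsupport f
  · simp [hx]
  · simp [hx, hc_lineDeriv_zero v hx]

theorem hc_integrable_mul {f k : E2 → ℝ} {C D : ℝ≥0} (hf : LipschitzWith C f)
    (h'f : HasCompactSupport f) (hk : LipschitzWith D k)
    (v v' : E2) : Integrable (fun x => lineDeriv ℝ f x v * lineDeriv ℝ k x v')
      (volume : Measure E2) :=
  (hc_integrable hf h'f v).mul_bdd (c := D * ‖v'‖) (aestronglyMeasurable_lineDeriv hk.continuous _)
    (.of_forall fun _ => norm_lineDeriv_le_of_lipschitz ℝ hk)

theorem hc_slope {f g : E2 → ℝ} {C : ℝ≥0} {M : ℝ} 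
    (hf : LipschitzWith C f) (h'f : HasCompactSupport f) (hg : Measurable g)
    (hM : ∀ x, ‖g x‖ ≤ M) (v : E2) :
    Filter.Tendsto (fun (t : ℝ) ↦ ∫ x, (t⁻¹ • (f (x + t • v) - f x)) * g x ∂(volume : Measure E2)) (𝓝[>] 0)
      (𝓝 (∫ x, lineDeriv ℝ f x v * g x ∂(volume : Measure E2))) := by
  let K := Metric.cthickening (‖v‖) (tsupport f)
  have K_compact : IsCompact K := IsCompact.cthickening h'f
  have hM0 : 0 ≤ M := (norm_nonneg _).trans (hM 0)
  apply tendsto_integral_filter_of_dominated_convergence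
      (K.indicator (fun x ↦ (C * ‖v‖) * M))
  · filter_upwards with t
    apply AEStronglyMeasurable.mul ?_ hg.aestronglyMeasurable
    apply aestronglyMeasurable_const.fun_smul
    apply AEStronglyMeasurable.sub _ hf.continuous.measurable.aestronglyMeasurable
    apply AEMeasurable.aestronglyMeasurable
    exact hf.continuous.measurable.comp_aemeasurable' (aemeasurable_id'.add_const _)
  · filter_upwards [Ioc_mem_nhdsGT zero_lt_one] with t ht
    have t_pos : 0 < t := ht.1
    filter_upwards with x
    by_cases hx : x ∈ K
    · calc ‖t⁻¹ • (f (x + t • v) - f x) * g x‖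
        = (t⁻¹ * ‖f (x + t • v) - f x‖) * ‖g x‖ := by simp [norm_mul, t_pos.le]
      _ ≤ (t⁻¹ * (C * ‖(x + t • v) - x‖)) * M := by
        gcongr
        · exact LipschitzWith.norm_sub_le hf (x + t • v) x
        · exact hM x
      _ = (C * ‖v‖) * M := by
        rw [add_sub_cancel_left, norm_smul, Real.norm_eq_abs, abs_of_nonneg t_pos.le]
        field_simp
      _ = K.indicator (fun x ↦ (C * ‖v‖) * M) x := by rw [indicator_of_mem hx]
    · have A : f x = 0 := by
        rw [← Function.notMem_support]
        contrapose hx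
        exact Metric.self_subset_cthickening _ (subset_tsupport _ hx)
      have B : f (x + t • v) = 0 := by
        rw [← Function.notMem_support]
        contrapose hx
        apply Metric.mem_cthickening_of_dist_le _ _ (‖v‖) (tsupport f) (subset_tsupport _ hx)
        simp only [dist_eq_norm, sub_add_cancel_left, norm_neg, norm_smul, Real.norm_eq_abs,
          abs_of_nonneg t_pos.le]
        exact mul_le_of_le_one_left (norm_nonneg v) ht.2
      simp only [B, A, _root_.sub_self, smul_eq_mul, mul_zero, zero_mul, norm_zero]
      exact indicator_nonneg (fun y _hy ↦ by positivity) _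
  · rw [integrable_indicator_iff K_compact.measurableSet]
    exact ContinuousOn.integrableOn_compact K_compact (by fun_prop)
  · filter_upwards [hf.ae_lineDifferentiableAt v] with x hx
    exact hx.hasLineDerivAt.tendsto_slope_zero_right.mul tendsto_const_nhds

theorem hc_lineDeriv_shift (k : E2 → ℝ) (x a v : E2) :
    lineDeriv ℝ (fun y => k (y + a)) x v = lineDeriv ℝ k (x + a) v := by
  simp only [lineDeriv]
  congr 1
  ext t
  congr 1
  abel

/-- Jacobians of Lipschitz pairs are null Lagrangians. -/
theorem hc_null {f k : E2 → ℝ} {C D : ℝ≥0} (hf : LipschitzWith C f)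
    (h'f : HasCompactSupport f) (hk : LipschitzWith D k) (v v' : E2) :
    ∫ x, lineDeriv ℝ f x v * lineDeriv ℝ k x v' ∂(volume : Measure E2)
      = ∫ x, lineDeriv ℝ f x v' * lineDeriv ℝ k x v ∂(volume : Measure E2) := by
  have A := hk.integral_inv_smul_sub_mul_tendsto_integral_lineDeriv_mul (hc_integrable hf h'f v) v'
  have B := hc_slope hf h'f (measurable_lineDeriv (𝕜 := ℝ) (f := k) (v := v) hk.continuous) (M := D * ‖v‖)
    (fun x => norm_lineDeriv_le_of_lipschitz ℝ hk) (-v')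
  have neg : ∀ h : E2 → ℝ, ∀ x w : E2, lineDeriv ℝ h x (-w) = - lineDeriv ℝ h x w :=
    fun h x w => lineDeriv_neg
  -- for each t
  have S : ∀ t : ℝ, ∫ x, (t⁻¹ • (k (x + t • v') - k x)) * lineDeriv ℝ f x v ∂(volume : Measure E2)
      = - ∫ x, (t⁻¹ • (f (x + t • (-v')) - f x)) * lineDeriv ℝ k x v ∂(volume : Measure E2) := by
    intro t
    have kt : LipschitzWith D (fun y => k (y + t • v')) := by
      simpa [Function.comp_def] using hk.comp (LipschitzWith.of_edist_le (fun x y => by simp) : LipschitzWith 1 (fun y : E2 => y + t • v'))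
    have i1 := kt.integral_lineDeriv_mul_eq (μ := (volume : Measure E2)) hf h'f v
    have i2 := hk.integral_lineDeriv_mul_eq (μ := (volume : Measure E2)) hf h'f v
    simp only [neg, hc_lineDeriv_shift] at i1 i2
    have i3 : ∫ x, lineDeriv ℝ k (x + t • v') v * f x ∂(volume : Measure E2)
       = ∫ x, lineDeriv ℝ k x v * f (x + t • (-v')) ∂(volume : Measure E2) := by
      rw [← integral_add_right_eq_self _ (t • (-v'))]; simp
    have I1 : Integrable (fun x => k (x + t • v') * lineDeriv ℝ f x v) (volume : Measure E2) := by
      have := (hc_integrable hf h'f v)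
      have h1 : IntegrableOn (fun x => k (x + t • v') * lineDeriv ℝ f x v) (tsupport f) (volume : Measure E2) :=
        this.integrableOn.continuousOn_mul kt.continuous.continuousOn h'f
      rw [← integrable_indicator_iff (isClosed_tsupport f).measurableSet] at h1
      refine h1.congr (Filter.Eventually.of_forall fun x => ?_)
      by_cases hx : x ∈ tsupport f
      · simp [hx]
      · simp [hx, hc_lineDeriv_zero v hx]
    have I2 : Integrable (fun x => k x * lineDeriv ℝ f x v) (volume : Measure E2) := by
      have := (hc_integrable hf h'f v)
      have h1 : IntegrableOn (fun x => k x * lineDeriv ℝ f x v) (tsupport f) (volume : Measure E2) :=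
        this.integrableOn.continuousOn_mul hk.continuous.continuousOn h'f
      rw [← integrable_indicator_iff (isClosed_tsupport f).measurableSet] at h1
      refine h1.congr (Filter.Eventually.of_forall fun x => ?_)
      by_cases hx : x ∈ tsupport f
      · simp [hx]
      · simp [hx, hc_lineDeriv_zero v hx]
    have bd : ∀ᵐ x ∂(volume : Measure E2), ‖lineDeriv ℝ k x v‖ ≤ D * ‖v‖ :=
      .of_forall fun x => norm_lineDeriv_le_of_lipschitz ℝ hk
    have fi := hf.continuous.integrable_of_hasCompactSupport (μ := (volume : Measure E2)) h'f
    have I4 : Integrable (fun x => lineDeriv ℝ k x v * f x) (volume : Measure E2) :=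
      fi.bdd_mul (aestronglyMeasurable_lineDeriv hk.continuous _) bd
    have I3 : Integrable (fun x => lineDeriv ℝ k x v * f (x + t • (-v'))) (volume : Measure E2) :=
      (fi.comp_add_right (t • (-v'))).bdd_mul (aestronglyMeasurable_lineDeriv hk.continuous _) bd
    have e1 : (fun x => (t⁻¹ • (k (x + t • v') - k x)) * lineDeriv ℝ f x v)
        = fun x => t⁻¹ * (k (x + t • v') * lineDeriv ℝ f x v - k x * lineDeriv ℝ f x v) := by
      ext x; simp only [smul_eq_mul]; ring
    have e2 : (fun x => (t⁻¹ • (f (x + t • (-v')) - f x)) * lineDeriv ℝ k x v)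
        = fun x => t⁻¹ * (lineDeriv ℝ k x v * f (x + t • (-v')) - lineDeriv ℝ k x v * f x) := by
      ext x; simp only [smul_eq_mul]; ring
    rw [e1, e2, integral_const_mul, integral_const_mul, integral_sub I1 I2, integral_sub I3 I4,
      ← i3, i1, i2]
    simp only [neg_mul, integral_neg, mul_comm (lineDeriv ℝ f _ _)]
    ring
  simp only [S] at A
  have := tendsto_nhds_unique A B.neg
  simp only [neg, neg_mul, integral_neg, neg_neg] at this
  rw [← this]
  simp only [mul_comm]
open Matrix Real Set MeasureTheory
open scoped Topology NNReal ENNReal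

theorem hc_lineDeriv_quot {φ w1 w2 : E2 → ℝ} {δ : ℝ} (hδ : 0 < δ) {x v : E2} {p a b : ℝ}
    (hφ : HasLineDerivAt ℝ φ p x v) (h1 : HasLineDerivAt ℝ w1 a x v)
    (h2 : HasLineDerivAt ℝ w2 b x v) :
    HasLineDerivAt ℝ (fun y => φ y ^ 2 * (w1 y / √(w1 y ^ 2 + w2 y ^ 2 + δ ^ 2)))
      (2 * φ x * p * w1 x / √(w1 x ^ 2 + w2 x ^ 2 + δ ^ 2)
        + φ x ^ 2 * (a / √(w1 x ^ 2 + w2 x ^ 2 + δ ^ 2)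
          - w1 x * (w1 x * a + w2 x * b) / √(w1 x ^ 2 + w2 x ^ 2 + δ ^ 2) ^ 3)) x v := by
  unfold HasLineDerivAt at *
  have hpos : 0 < w1 x ^ 2 + w2 x ^ 2 + δ ^ 2 := by positivity
  have hN := Real.sqrt_pos.2 hpos
  have hs := (((h1.pow 2).add (h2.pow 2)).add_const (δ ^ 2)).sqrt (by simpa using hpos.ne')
  have := (hφ.pow 2).mul (h1.div hs (by simpa using hN.ne'))
  refine this.congr_deriv ?_
  simp only [Pi.pow_apply, Pi.add_apply, zero_smul, add_zero, Pi.div_apply]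
  set N := √(w1 x ^ 2 + w2 x ^ 2 + δ ^ 2)
  field_simp
  norm_num
  ring

theorem hc_algebra {φ w1 w2 N δ pt ph at' ah bt bh : ℝ} (hN : 0 < N)
    (hN2 : N ^ 2 = w1 ^ 2 + w2 ^ 2 + δ ^ 2) :
    ((2 * φ * pt * w1 / N + φ ^ 2 * (at' / N - w1 * (w1 * at' + w2 * bt) / N ^ 3)) * bh
      - (2 * φ * ph * w1 / N + φ ^ 2 * (ah / N - w1 * (w1 * ah + w2 * bh) / N ^ 3)) * bt)
    - ((2 * φ * pt * w2 / N + φ ^ 2 * (bt / N - w2 * (w2 * bt + w1 * at') / N ^ 3)) * ah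
      - (2 * φ * ph * w2 / N + φ ^ 2 * (bh / N - w2 * (w2 * bh + w1 * ah) / N ^ 3)) * at')
    = φ ^ 2 * (at' * bh - ah * bt) * ((N ^ 2 + δ ^ 2) / N ^ 3)
      + 2 * φ * ((w1 / N) * (pt * bh - ph * bt) - (w2 / N) * (pt * ah - ph * at')) := by
  have : δ ^ 2 = N ^ 2 - w1 ^ 2 - w2 ^ 2 := by linarith
  rw [this]
  field_simp
  ring

theorem hc_second_bound {φ x1 x2 pt ph at' ah bt bh Λ : ℝ} (h0 : 0 ≤ φ) (h1 : φ ≤ 1)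
    (hx1 : |x1| ≤ 1) (hx2 : |x2| ≤ 1) (hpt : |pt| ≤ 1) (hph : |ph| ≤ 1)
    (hat : |at'| ≤ Λ) (hah : |ah| ≤ Λ) (hbt : |bt| ≤ Λ) (hbh : |bh| ≤ Λ) :
    -(8 * Λ) ≤ 2 * φ * (x1 * (pt * bh - ph * bt) - x2 * (pt * ah - ph * at')) := by
  have key : ∀ a b : ℝ, |a| ≤ 1 → |b| ≤ Λ → |a * b| ≤ Λ := by
    intro a b ha hb
    rw [abs_mul]
    calc |a| * |b| ≤ 1 * Λ := mul_le_mul ha hb (abs_nonneg _) zero_le_one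
      _ = Λ := one_mul _
  have hΛ : 0 ≤ Λ := (abs_nonneg _).trans hat
  have k1 := abs_le.1 (key _ _ hpt hbh)
  have k2 := abs_le.1 (key _ _ hph hbt)
  have k3 := abs_le.1 (key _ _ hpt hah)
  have k4 := abs_le.1 (key _ _ hph hat)
  have j1 : |pt * bh - ph * bt| ≤ 2 * Λ := abs_le.2 ⟨by linarith [k1.1, k2.2], by linarith [k1.2, k2.1]⟩
  have j2 : |pt * ah - ph * at'| ≤ 2 * Λ := abs_le.2 ⟨by linarith [k3.1, k4.2], by linarith [k3.2, k4.1]⟩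
  have key2 : ∀ a b : ℝ, |a| ≤ 1 → |b| ≤ 2 * Λ → |a * b| ≤ 2 * Λ := by
    intro a b ha hb
    rw [abs_mul]
    calc |a| * |b| ≤ 1 * (2 * Λ) := mul_le_mul ha hb (abs_nonneg _) zero_le_one
      _ = 2 * Λ := one_mul _
  have l1 := abs_le.1 (key2 _ _ hx1 j1)
  have l2 := abs_le.1 (key2 _ _ hx2 j2)
  set y := x1 * (pt * bh - ph * bt) - x2 * (pt * ah - ph * at')
  have hy : -(4 * Λ) ≤ y := by simp only [y]; linarith [l1.1, l2.2]
  nlinarith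

theorem hc_first_bound {φ J N δ Λ : ℝ} (h0 : 0 ≤ φ) (h1 : φ ≤ 1) (hδ : 0 < δ) (hN : δ ≤ N)
    (hJ : -(2 * Λ ^ 2) ≤ J) : -(4 * Λ ^ 2 / δ) ≤ φ ^ 2 * J * ((N ^ 2 + δ ^ 2) / N ^ 3) := by
  have hN0 : 0 < N := hδ.trans_le hN
  have a1 : (N ^ 2 + δ ^ 2) / N ^ 3 ≤ 2 / δ := by
    rw [div_le_div_iff₀ (by positivity) hδ]
    have : δ ^ 2 ≤ N ^ 2 := by gcongr
    calc (N ^ 2 + δ ^ 2) * δ ≤ (N ^ 2 + N ^ 2) * N := by gcongr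
      _ = 2 * N ^ 3 := by ring
  have a0 : 0 ≤ (N ^ 2 + δ ^ 2) / N ^ 3 := by positivity
  have a2 : φ ^ 2 ≤ 1 := by nlinarith
  have : φ ^ 2 * ((N ^ 2 + δ ^ 2) / N ^ 3) ≤ 2 / δ := by
    calc φ ^ 2 * ((N ^ 2 + δ ^ 2) / N ^ 3) ≤ 1 * (2 / δ) := by gcongr
      _ = _ := one_mul _
  have b0 : 0 ≤ φ ^ 2 * ((N ^ 2 + δ ^ 2) / N ^ 3) := by positivity
  set y := φ ^ 2 * ((N ^ 2 + δ ^ 2) / N ^ 3)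
  have e : φ ^ 2 * J * ((N ^ 2 + δ ^ 2) / N ^ 3) = y * J := by simp only [y]; ring
  rw [e]
  calc -(4 * Λ ^ 2 / δ) = (2 / δ) * (-(2 * Λ ^ 2)) := by ring
    _ ≤ y * (-(2 * Λ ^ 2)) := by nlinarith [sq_nonneg Λ]
    _ ≤ y * J := by gcongr

theorem hc_main_bound {φ J N δ c Λ h : ℝ} (hφ : 1 / 2 ≤ φ) (hc : 0 < c)
    (hN0 : 0 < N) (hh : 0 < h) (hΛ : 0 ≤ Λ) (hN : N ≤ (4 * Λ + 1) * h)
    (hJ : c ≤ J) : c / (4 * (4 * Λ + 1)) * h⁻¹ ≤ φ ^ 2 * J * ((N ^ 2 + δ ^ 2) / N ^ 3) := by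
  have a1 : N⁻¹ ≤ (N ^ 2 + δ ^ 2) / N ^ 3 := by
    rw [le_div_iff₀ (by positivity)]
    have : N⁻¹ * N ^ 3 = N ^ 2 := by field_simp
    nlinarith [sq_nonneg δ]
  have a2 : ((4 * Λ + 1) * h)⁻¹ ≤ N⁻¹ := by gcongr
  have a3 : (1 / 4 : ℝ) ≤ φ ^ 2 := by nlinarith
  calc c / (4 * (4 * Λ + 1)) * h⁻¹ = 1 / 4 * c * ((4 * Λ + 1) * h)⁻¹ := by field_simp
    _ ≤ φ ^ 2 * J * ((N ^ 2 + δ ^ 2) / N ^ 3) := by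
      have hJ0 : 0 < J := hc.trans_le hJ
      have := a2.trans a1
      gcongr

theorem hc_N_bound {N δ h Λ a b : ℝ} (hN2 : N ^ 2 = a ^ 2 + b ^ 2 + δ ^ 2) (hδ : 0 < δ) (hx : δ < h)
    (hΛ : 0 ≤ Λ) (ha : |a| ≤ Λ * (2 * h)) (hb : |b| ≤ Λ * (2 * h)) : N ≤ (4 * Λ + 1) * h := by
  have hh0 : 0 < h := hδ.trans hx
  apply le_of_sq_le_sq _ (by positivity)
  rw [hN2]
  have a' := sq_le_sq' (by linarith [abs_nonneg a]) ha
  have b' := sq_le_sq' (by linarith [abs_nonneg b]) hb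
  rw [sq_abs] at a' b'
  have : δ ^ 2 ≤ h ^ 2 := by gcongr
  have hh : 0 ≤ Λ * h ^ 2 := by positivity
  have hh2 : 0 ≤ Λ ^ 2 * h ^ 2 := by positivity
  nlinarith

/-- the cutoff -/
noncomputable def hcPhi (x : E2) : ℝ := max (1 - ‖x‖) 0

theorem hcPhi_lip : LipschitzWith 1 hcPhi := by
  have h1 : LipschitzWith 1 (fun x : E2 => 1 - ‖x‖) := by
    refine LipschitzWith.of_dist_le_mul fun x y => ?_
    simp only [NNReal.coe_one, one_mul, dist_eq_norm]
    have := abs_norm_sub_norm_le x y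
    rw [abs_sub_comm] at this
    rw [Real.norm_eq_abs]
    convert this using 2; ring
  exact h1.max_const 0

theorem hcPhi_nonneg (x : E2) : 0 ≤ hcPhi x := le_max_right _ _
theorem hcPhi_le (x : E2) : hcPhi x ≤ 1 := max_le (by linarith [norm_nonneg x]) zero_le_one

theorem hc_f_lip {w1 w2 : E2 → ℝ} {Λ : ℝ≥0} {M δ : ℝ} (hδ : 0 < δ) (h1 : LipschitzWith Λ w1)
    (h2 : LipschitzWith Λ w2) (b1 : ∀ x, |w1 x| ≤ M) (b2 : ∀ x, |w2 x| ≤ M) :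
    ∃ C, LipschitzWith C (fun y => hcPhi y ^ 2 * (w1 y / √(w1 y ^ 2 + w2 y ^ 2 + δ ^ 2))) := by
  let H : ℝ × ℝ × ℝ → ℝ := fun z => z.1 ^ 2 * (z.2.1 / √(z.2.1 ^ 2 + z.2.2 ^ 2 + δ ^ 2))
  have hpos : ∀ z : ℝ × ℝ × ℝ, z.2.1 ^ 2 + z.2.2 ^ 2 + δ ^ 2 ≠ 0 := fun z => by positivity
  have hH : ContDiff ℝ 1 H := by
    have hs : ContDiff ℝ 1 (fun z : ℝ × ℝ × ℝ => √(z.2.1 ^ 2 + z.2.2 ^ 2 + δ ^ 2)) :=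
      ContDiff.sqrt (by fun_prop) hpos
    have : ∀ z : ℝ × ℝ × ℝ, √(z.2.1 ^ 2 + z.2.2 ^ 2 + δ ^ 2) ≠ 0 := fun z => by positivity
    exact (contDiff_fst.pow 2).mul (ContDiff.div (by fun_prop) hs this)
  let K : Set (ℝ × ℝ × ℝ) := Icc 0 1 ×ˢ Icc (-M) M ×ˢ Icc (-M) M
  obtain ⟨C, hC⟩ := hH.contDiffOn (s := K) |>.exists_lipschitzOnWith one_ne_zero
    ((convex_Icc _ _).prod ((convex_Icc _ _).prod (convex_Icc _ _)))
    (isCompact_Icc.prod (isCompact_Icc.prod isCompact_Icc))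
  have hp := hcPhi_lip.prodMk (h1.prodMk h2)
  refine ⟨_, lipschitzOnWith_univ.1 (hC.comp (lipschitzOnWith_univ.2 hp) ?_)⟩
  intro x _
  exact ⟨⟨hcPhi_nonneg x, hcPhi_le x⟩, abs_le.1 (b1 x), abs_le.1 (b2 x)⟩

theorem hc_f_supp {w : E2 → ℝ} :
    HasCompactSupport (fun y => hcPhi y ^ 2 * w y) := by
  refine HasCompactSupport.intro (isCompact_closedBall (0 : E2) 1) ?_
  intro x hx
  have : 1 < ‖x‖ := by simpa using hx
  have : hcPhi x = 0 := max_eq_right (by linarith)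
  simp [this]

set_option maxHeartbeats 1000000 in
theorem hc_core_aux {w1 w2 : E2 → ℝ} {Λ : ℝ≥0} {M δ c : ℝ} (hδ : 0 < δ) (hδ2 : δ < 1 / 2)
    (hc : 0 < c) (h1 : LipschitzWith Λ w1)
    (h2 : LipschitzWith Λ w2) (b1 : ∀ x, |w1 x| ≤ M) (b2 : ∀ x, |w2 x| ≤ M)
    (z1 : ∀ x : E2, x.2 ≤ -δ → w1 x = 0) (z2 : ∀ x : E2, x.2 ≤ -δ → w2 x = 0)
    (hJ : ∀ᵐ x ∂(volume : Measure E2), ‖x‖ < 1 → δ < x.2 →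
      c ≤ lineDeriv ℝ w1 x (1,0) * lineDeriv ℝ w2 x (0,1)
        - lineDeriv ℝ w1 x (0,1) * lineDeriv ℝ w2 x (1,0)) :
    c / (4 * (4 * Λ + 1)) * Real.log (1 / 2 / δ) ≤ 32 * Λ + 16 * (Λ : ℝ) ^ 2 := by
  set f1 : E2 → ℝ := fun y => hcPhi y ^ 2 * (w1 y / √(w1 y ^ 2 + w2 y ^ 2 + δ ^ 2)) with hf1
  set f2 : E2 → ℝ := fun y => hcPhi y ^ 2 * (w2 y / √(w2 y ^ 2 + w1 y ^ 2 + δ ^ 2)) with hf2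
  obtain ⟨C1, l1⟩ := hc_f_lip hδ h1 h2 b1 b2
  obtain ⟨C2, l2⟩ := hc_f_lip hδ h2 h1 b2 b1
  rw [← hf1] at l1
  rw [← hf2] at l2
  have s1 : HasCompactSupport f1 := hc_f_supp
  have s2 : HasCompactSupport f2 := hc_f_supp
  have n1 := hc_null l1 s1 h2 (1,0) (0,1)
  have n2 := hc_null l2 s2 h1 (1,0) (0,1)
  set I : E2 → ℝ := fun x => (lineDeriv ℝ f1 x (1,0) * lineDeriv ℝ w2 x (0,1)
      - lineDeriv ℝ f1 x (0,1) * lineDeriv ℝ w2 x (1,0))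
      - (lineDeriv ℝ f2 x (1,0) * lineDeriv ℝ w1 x (0,1)
      - lineDeriv ℝ f2 x (0,1) * lineDeriv ℝ w1 x (1,0)) with hI
  have i1 := hc_integrable_mul l1 s1 h2 (1,0) (0,1)
  have i2 := hc_integrable_mul l1 s1 h2 (0,1) (1,0)
  have i3 := hc_integrable_mul l2 s2 h1 (1,0) (0,1)
  have i4 := hc_integrable_mul l2 s2 h1 (0,1) (1,0)
  have Iint : Integrable I (volume : Measure E2) := (i1.sub i2).sub (i3.sub i4)
  have I0 : ∫ x, I x ∂(volume : Measure E2) = 0 := by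
    refine (integral_sub (i1.sub i2) (i3.sub i4)).trans ?_
    rw [integral_sub' i1 i2, integral_sub' i3 i4, n1, n2]
    simp
  -- the minorant
  set κ := c / (4 * (4 * (Λ : ℝ) + 1)) with hκ
  let Q : Set E2 := Icc (-(1/2) : ℝ) (1/2) ×ˢ Ioc δ (1/2)
  let Bx : Set E2 := Icc (-1 : ℝ) 1 ×ˢ Icc (-1 : ℝ) 1
  let S : Set E2 := Icc (-1 : ℝ) 1 ×ˢ Icc (-δ) δ
  have mQ : MeasurableSet Q := measurableSet_Icc.prod measurableSet_Ioc
  have mB : MeasurableSet Bx := measurableSet_Icc.prod measurableSet_Icc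
  have mS : MeasurableSet S := measurableSet_Icc.prod measurableSet_Icc
  let G1 : E2 → ℝ := Q.indicator (fun x => κ * x.2⁻¹)
  let G2 : E2 → ℝ := Bx.indicator (fun _ => 8 * (Λ : ℝ))
  let G3 : E2 → ℝ := S.indicator (fun _ => 4 * (Λ : ℝ) ^ 2 / δ)
  have iG1 : Integrable G1 (volume : Measure E2) := by
    rw [integrable_indicator_iff mQ]
    have : IntegrableOn (fun x : E2 => κ * x.2⁻¹) (Icc (-(1/2) : ℝ) (1/2) ×ˢ Icc δ (1/2)) volume := by
      apply ContinuousOn.integrableOn_compact (isCompact_Icc.prod isCompact_Icc)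
      apply continuousOn_const.mul
      apply continuousOn_snd.inv₀
      intro x hx
      exact (hδ.trans_le hx.2.1).ne'
    exact this.mono_set (prod_mono subset_rfl Ioc_subset_Icc_self)
  have vB : (volume : Measure E2).real Bx = 4 := by
    simp only [Bx, measureReal_def, Measure.volume_eq_prod, Measure.prod_prod, Real.volume_Icc, ENNReal.toReal_mul]
    rw [ENNReal.toReal_ofReal (by norm_num)]; norm_num
  have vS : (volume : Measure E2).real S = 4 * δ := by
    simp only [S, measureReal_def, Measure.volume_eq_prod, Measure.prod_prod, Real.volume_Icc, ENNReal.toReal_mul]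
    rw [ENNReal.toReal_ofReal (by norm_num), ENNReal.toReal_ofReal (by linarith)]; ring
  have fB : (volume : Measure E2) Bx ≠ ⊤ := (isCompact_Icc.prod isCompact_Icc).measure_lt_top.ne
  have fS : (volume : Measure E2) S ≠ ⊤ := (isCompact_Icc.prod isCompact_Icc).measure_lt_top.ne
  have iG2 : Integrable G2 (volume : Measure E2) := by
    rw [integrable_indicator_iff mB]; exact integrableOn_const fB
  have iG3 : Integrable G3 (volume : Measure E2) := by
    rw [integrable_indicator_iff mS]; exact integrableOn_const fS
  have e1 : ∫ x, G1 x ∂(volume : Measure E2) = κ * Real.log (1 / 2 / δ) := by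
    simp only [G1, Q]
    rw [integral_indicator mQ, integral_const_mul]
    congr 1
    have := setIntegral_prod_mul (μ := (volume : Measure ℝ)) (ν := (volume : Measure ℝ))
      (fun _ => (1:ℝ)) (fun y => y⁻¹) (Icc (-(1/2) : ℝ) (1/2)) (Ioc δ (1/2))
    simp only [one_mul] at this
    rw [Measure.volume_eq_prod, this, ← intervalIntegral.integral_of_le hδ2.le,
      integral_inv_of_pos hδ (by norm_num)]
    simp; norm_num
  have e2 : ∫ x, G2 x ∂(volume : Measure E2) = 32 * Λ := by
    simp only [G2]
    rw [integral_indicator mB, setIntegral_const, vB, smul_eq_mul]; ring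
  have e3 : ∫ x, G3 x ∂(volume : Measure E2) = 16 * (Λ : ℝ) ^ 2 := by
    simp only [G3]
    rw [integral_indicator mS, setIntegral_const, vS, smul_eq_mul]; field_simp; ring
  have key : ∀ᵐ x ∂(volume : Measure E2), G1 x - G2 x - G3 x ≤ I x := by
    filter_upwards [hJ, hcPhi_lip.ae_lineDifferentiableAt (1,0), hcPhi_lip.ae_lineDifferentiableAt (0,1),
      h1.ae_lineDifferentiableAt (1,0), h1.ae_lineDifferentiableAt (0,1),
      h2.ae_lineDifferentiableAt (1,0), h2.ae_lineDifferentiableAt (0,1)]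
      with x hJx dpt dph dat dah dbt dbh
    have q1 := (hc_lineDeriv_quot hδ dpt.hasLineDerivAt dat.hasLineDerivAt dbt.hasLineDerivAt).lineDeriv
    have q2 := (hc_lineDeriv_quot hδ dph.hasLineDerivAt dah.hasLineDerivAt dbh.hasLineDerivAt).lineDeriv
    have q3 := (hc_lineDeriv_quot hδ dpt.hasLineDerivAt dbt.hasLineDerivAt dat.hasLineDerivAt).lineDeriv
    have q4 := (hc_lineDeriv_quot hδ dph.hasLineDerivAt dbh.hasLineDerivAt dah.hasLineDerivAt).lineDeriv
    rw [add_comm (w2 x ^ 2)] at q3 q4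
    have nv1 : ‖((1:ℝ),(0:ℝ))‖ = 1 := by simp
    have nv2 : ‖((0:ℝ),(1:ℝ))‖ = 1 := by simp
    have ppt : |lineDeriv ℝ hcPhi x (1,0)| ≤ 1 := by
      simpa [nv1] using norm_lineDeriv_le_of_lipschitz ℝ hcPhi_lip (x₀ := x) (v := (1,0))
    have pph : |lineDeriv ℝ hcPhi x (0,1)| ≤ 1 := by
      simpa [nv2] using norm_lineDeriv_le_of_lipschitz ℝ hcPhi_lip (x₀ := x) (v := (0,1))
    have pat : |lineDeriv ℝ w1 x (1,0)| ≤ Λ := by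
      simpa [nv1] using norm_lineDeriv_le_of_lipschitz ℝ h1 (x₀ := x) (v := (1,0))
    have pah : |lineDeriv ℝ w1 x (0,1)| ≤ Λ := by
      simpa [nv2] using norm_lineDeriv_le_of_lipschitz ℝ h1 (x₀ := x) (v := (0,1))
    have pbt : |lineDeriv ℝ w2 x (1,0)| ≤ Λ := by
      simpa [nv1] using norm_lineDeriv_le_of_lipschitz ℝ h2 (x₀ := x) (v := (1,0))
    have pbh : |lineDeriv ℝ w2 x (0,1)| ≤ Λ := by
      simpa [nv2] using norm_lineDeriv_le_of_lipschitz ℝ h2 (x₀ := x) (v := (0,1))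
    have hpos : 0 < w1 x ^ 2 + w2 x ^ 2 + δ ^ 2 := by positivity
    have hIx := hc_algebra (φ := hcPhi x) (pt := lineDeriv ℝ hcPhi x (1,0))
      (ph := lineDeriv ℝ hcPhi x (0,1)) (at' := lineDeriv ℝ w1 x (1,0))
      (ah := lineDeriv ℝ w1 x (0,1)) (bt := lineDeriv ℝ w2 x (1,0)) (bh := lineDeriv ℝ w2 x (0,1))
      (Real.sqrt_pos.2 hpos) (Real.sq_sqrt hpos.le)
    rw [← q1, ← q2, ← q3, ← q4] at hIx
    change I x = _ at hIx
    have zJ : x.2 < -δ → lineDeriv ℝ w1 x (1,0) = 0 ∧ lineDeriv ℝ w1 x (0,1) = 0 := by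
      intro hx
      have : w1 =ᶠ[𝓝 x] 0 := by
        filter_upwards [(isOpen_Iio (a := -δ)).preimage continuous_snd |>.mem_nhds hx] with y hy
        exact z1 y (le_of_lt hy)
      have h2 : HasFDerivAt w1 (0 : E2 →L[ℝ] ℝ) x :=
        (hasFDerivAt_const (0:ℝ) x).congr_of_eventuallyEq this
      exact ⟨by simpa using (h2.hasLineDerivAt (1,0)).lineDeriv,
        by simpa using (h2.hasLineDerivAt (0,1)).lineDeriv⟩
    have hw : ∀ w : E2 → ℝ, LipschitzWith Λ w → (∀ x : E2, x.2 ≤ -δ → w x = 0) → δ < x.2 →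
        |w x| ≤ Λ * (2 * x.2) := by
      intro w hw hz hx
      have := hw.dist_le_mul x (x.1, -δ)
      rw [hz (x.1, -δ) le_rfl, Real.dist_eq, sub_zero, Prod.dist_eq] at this
      simp only [dist_self] at this
      have hd : dist x.2 (-δ) = x.2 + δ := by
        rw [Real.dist_eq, sub_neg_eq_add, abs_of_pos (by linarith)]
      rw [hd, max_eq_right (by linarith)] at this
      refine this.trans ?_
      gcongr; linarith
    have hw1 := hw w1 h1 z1
    have hw2 := hw w2 h2 z2
    clear hw q1 q2 q3 q4
    rw [hIx]
    clear hIx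
    generalize lineDeriv ℝ hcPhi x (1,0) = pt at *
    generalize lineDeriv ℝ hcPhi x (0,1) = ph at *
    generalize lineDeriv ℝ w1 x (1,0) = at' at *
    generalize lineDeriv ℝ w1 x (0,1) = ah at *
    generalize lineDeriv ℝ w2 x (1,0) = bt at *
    generalize lineDeriv ℝ w2 x (0,1) = bh at *
    have hΛ : (0:ℝ) ≤ Λ := Λ.2
    have hN2 : √(w1 x ^ 2 + w2 x ^ 2 + δ ^ 2) ^ 2 = w1 x ^ 2 + w2 x ^ 2 + δ ^ 2 := Real.sq_sqrt hpos.le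
    have hN0 := Real.sqrt_pos.2 hpos
    set N := √(w1 x ^ 2 + w2 x ^ 2 + δ ^ 2)
    have hφ0 := hcPhi_nonneg x
    have hφ1 := hcPhi_le x
    have hx1 : |w1 x / N| ≤ 1 := by
      rw [abs_div, abs_of_pos hN0, div_le_one hN0]
      exact abs_le_of_sq_le_sq (by nlinarith [sq_nonneg (w2 x), sq_nonneg δ]) hN0.le
    have hx2 : |w2 x / N| ≤ 1 := by
      rw [abs_div, abs_of_pos hN0, div_le_one hN0]
      exact abs_le_of_sq_le_sq (by nlinarith [sq_nonneg (w1 x), sq_nonneg δ]) hN0.le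
    have hδN : δ ≤ N := by
      apply le_of_sq_le_sq _ hN0.le
      nlinarith [sq_nonneg (w1 x), sq_nonneg (w2 x)]
    have B2 := hc_second_bound hφ0 hφ1 hx1 hx2 ppt pph pat pah pbt pbh
    by_cases hbox : ‖x‖ < 1
    · have hn := hbox
      rw [Prod.norm_def, max_lt_iff, Real.norm_eq_abs, Real.norm_eq_abs, abs_lt, abs_lt] at hn
      have xB : x ∈ Bx := ⟨⟨hn.1.1.le, hn.1.2.le⟩, ⟨hn.2.1.le, hn.2.2.le⟩⟩
      have g2 : G2 x = 8 * Λ := indicator_of_mem xB _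
      rcases lt_or_ge δ x.2 with hx | hx
      · have g3 : G3 x = 0 := indicator_of_notMem (fun h => absurd h.2.2 (not_le.2 hx)) _
        have J := hJx hbox hx
        by_cases xQ : x ∈ Q
        · have g1 : G1 x = κ * x.2⁻¹ := indicator_of_mem xQ _
          have hφ : 1 / 2 ≤ hcPhi x := by
            have : ‖x‖ ≤ 1 / 2 := by
              rw [Prod.norm_def, max_le_iff, Real.norm_eq_abs, Real.norm_eq_abs, abs_le, abs_le]
              exact ⟨⟨xQ.1.1, xQ.1.2⟩, by linarith [xQ.2.1], xQ.2.2⟩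
            exact le_max_of_le_left (by linarith)
          have hN : N ≤ (4 * Λ + 1) * x.2 := by
            exact hc_N_bound hN2 hδ hx hΛ (hw1 hx) (hw2 hx)
          have B1 := hc_main_bound (δ := δ) hφ hc hN0 (hδ.trans hx) hΛ hN J
          rw [g1, g2, g3]
          linarith
        · have g1 : G1 x = 0 := indicator_of_notMem xQ _
          have B1 : 0 ≤ hcPhi x ^ 2 * (at' * bh - ah * bt) * ((N ^ 2 + δ ^ 2) / N ^ 3) := by
            have := hc.le.trans J
            positivity
          rw [g1, g2, g3]
          linarith
      · have g1 : G1 x = 0 := indicator_of_notMem (fun h => absurd h.2.1 (not_lt.2 hx)) _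
        rcases lt_or_ge x.2 (-δ) with hx' | hx'
        · have g3 : G3 x = 0 := indicator_of_notMem (fun h => absurd h.2.1 (not_le.2 hx')) _
          obtain ⟨r1, r2⟩ := zJ hx'
          rw [g1, g2, g3]
          have : hcPhi x ^ 2 * (at' * bh - ah * bt) * ((N ^ 2 + δ ^ 2) / N ^ 3) = 0 := by
            rw [r1, r2]; ring
          linarith
        · have g3 : G3 x = 4 * (Λ : ℝ) ^ 2 / δ := indicator_of_mem (s := S) ⟨xB.1, hx', hx⟩ _
          have J : -(2 * (Λ : ℝ) ^ 2) ≤ at' * bh - ah * bt := by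
            have a : |at' * bh| ≤ Λ * Λ := by rw [abs_mul]; gcongr
            have b : |ah * bt| ≤ Λ * Λ := by rw [abs_mul]; gcongr
            have := (abs_le.1 a).1
            have := (abs_le.1 b).2
            nlinarith
          have B1 := hc_first_bound hφ0 hφ1 hδ hδN J
          rw [g1, g2, g3]
          linarith
    · have hφ : hcPhi x = 0 := max_eq_right (by linarith)
      have g1 : G1 x = 0 := by
        refine indicator_of_notMem (fun h => hbox ?_) _
        rw [Prod.norm_def, max_lt_iff, Real.norm_eq_abs, Real.norm_eq_abs, abs_lt, abs_lt]
        exact ⟨⟨by linarith [h.1.1], by linarith [h.1.2]⟩, by linarith [h.2.1], by linarith [h.2.2]⟩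
      have g2 : 0 ≤ G2 x := indicator_nonneg (fun _ _ => by positivity) _
      have g3 : 0 ≤ G3 x := indicator_nonneg (fun _ _ => by positivity) _
      rw [hφ, g1]
      simp
      linarith
  have := integral_mono_ae ((iG1.sub iG2).sub iG3) Iint key
  rw [I0, integral_sub' (iG1.sub iG2) iG3, integral_sub' iG1 iG2, e1, e2, e3] at this
  linarith

theorem hc_core (Λ : ℝ≥0) {c : ℝ} (hc : 0 < c) : ∃ δ : ℝ, 0 < δ ∧ δ < 1 / 2 ∧
    ∀ (w1 w2 : E2 → ℝ) (M : ℝ), LipschitzWith Λ w1 → LipschitzWith Λ w2 →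
    (∀ x, |w1 x| ≤ M) → (∀ x, |w2 x| ≤ M) → 
    (∀ x : E2, x.2 ≤ -δ → w1 x = 0) → (∀ x : E2, x.2 ≤ -δ → w2 x = 0) →
    (∀ᵐ x ∂(volume : Measure E2), ‖x‖ < 1 → δ < x.2 →
      c ≤ lineDeriv ℝ w1 x (1,0) * lineDeriv ℝ w2 x (0,1)
        - lineDeriv ℝ w1 x (0,1) * lineDeriv ℝ w2 x (1,0)) → False := by
  set κ := c / (4 * (4 * (Λ : ℝ) + 1)) with hκ
  have hκ0 : 0 < κ := by positivity
  set T := (32 * Λ + 16 * (Λ : ℝ) ^ 2 + 1) / κ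
  have hT : 0 < T := by positivity
  refine ⟨1 / 2 * Real.exp (-T), by positivity, ?_, ?_⟩
  · have : Real.exp (-T) < 1 := by rw [Real.exp_lt_one_iff]; linarith
    linarith
  · intro w1 w2 M h1 h2 b1 b2 z1 z2 hJ
    have hlt : 1 / 2 * Real.exp (-T) < 1 / 2 := by
      have : Real.exp (-T) < 1 := by rw [Real.exp_lt_one_iff]; linarith
      linarith
    have := hc_core_aux (by positivity) hlt hc h1 h2 b1 b2 z1 z2 hJ
    have e : (1 / 2 : ℝ) / (1 / 2 * Real.exp (-T)) = Real.exp T := by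
      rw [Real.exp_neg]; field_simp
    rw [e, Real.log_exp, ← hκ] at this
    have e2 : κ * T = 32 * Λ + 16 * (Λ : ℝ) ^ 2 + 1 := by simp only [T]; field_simp
    linarith


open scoped Topology NNReal ENNReal

theorem hc_const1 {v : E2 → ℝ} {C : ℝ≥0} {a1 b1 a2 b2 : ℝ} (h1 : a1 < b1) (h2 : a2 < b2)
    (hv : LipschitzOnWith C v (Icc a1 b1 ×ˢ Icc a2 b2))
    (h0 : ∀ᵐ x ∂(volume : Measure E2), x.1 ∈ Ioo a1 b1 → x.2 ∈ Ioo a2 b2 →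
      HasFDerivAt v (0 : E2 →L[ℝ] ℝ) x) :
    ∀ t ∈ Icc a1 b1, ∀ h ∈ Icc a2 b2, v (t, h) = v (t, a2) := by
  have hae : ∀ᵐ t ∂(volume : Measure ℝ), t ∈ Ioo a1 b1 → ∀ h ∈ Icc a2 b2, v (t, h) = v (t, a2) := by
    have := Measure.ae_ae_of_ae_prod (μ := (volume : Measure ℝ)) (ν := (volume : Measure ℝ)) h0
    filter_upwards [this] with t ht htm
    have lip : LipschitzOnWith C (fun h => v (t, h)) (uIcc a2 b2) := by
      rw [uIcc_of_le h2.le]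
      refine LipschitzOnWith.of_dist_le_mul fun x hx y hy => ?_
      have := hv.dist_le_mul (t, x) ⟨Ioo_subset_Icc_self htm, hx⟩ (t, y) ⟨Ioo_subset_Icc_self htm, hy⟩
      simpa [Prod.dist_eq] using this
    have := lip.absolutelyContinuousOnInterval.const_of_ae_hasDerivAt_zero ?_
    · obtain ⟨K, hK⟩ := this
      rw [uIcc_of_le h2.le] at hK
      intro h hh
      exact (hK h hh).trans (hK a2 ⟨le_rfl, h2.le⟩).symm
    · have n1 : ∀ᵐ x ∂(volume : Measure ℝ), x ≠ a2 := by simp [ae_iff]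
      have n2 : ∀ᵐ x ∂(volume : Measure ℝ), x ≠ b2 := by simp [ae_iff]
      filter_upwards [ht, n1, n2] with x hx m1 m2 hm
      rw [uIcc_of_le h2.le] at hm
      have hf := hx htm ⟨lt_of_le_of_ne hm.1 (Ne.symm m1), lt_of_le_of_ne hm.2 m2⟩
      have hd : HasDerivAt (fun h : ℝ => ((t, h) : E2)) (0, 1) x :=
        (hasDerivAt_const x t).prodMk (hasDerivAt_id x)
      simpa [Function.comp_def] using hf.comp_hasDerivAt x hd
  intro t ht h hh
  have := Measure.eqOn_Icc_of_ae_eq (μ := (volume : Measure ℝ)) (f := fun t => v (t, h))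
    (g := fun t => v (t, a2)) h1.ne ?_ ?_ ?_
  · exact this ht
  · have n1 : ∀ᵐ x ∂(volume : Measure ℝ), x ≠ a1 := by simp [ae_iff]
    have n2 : ∀ᵐ x ∂(volume : Measure ℝ), x ≠ b1 := by simp [ae_iff]
    rw [Filter.EventuallyEq, ae_restrict_iff' measurableSet_Icc]
    filter_upwards [hae, n1, n2] with x hx m1 m2 hm
    exact hx ⟨lt_of_le_of_ne hm.1 (Ne.symm m1), lt_of_le_of_ne hm.2 m2⟩ h hh
  · exact hv.continuousOn.comp (by fun_prop) (fun x hx => ⟨hx, hh⟩)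
  · exact hv.continuousOn.comp (by fun_prop) (fun x hx => ⟨hx, ⟨le_rfl, h2.le⟩⟩)

theorem hc_const {v : E2 → ℝ} {C : ℝ≥0} {a1 b1 a2 b2 : ℝ} (h1 : a1 < b1) (h2 : a2 < b2)
    (hv : LipschitzOnWith C v (Icc a1 b1 ×ˢ Icc a2 b2))
    (h0 : ∀ᵐ x ∂(volume : Measure E2), x.1 ∈ Ioo a1 b1 → x.2 ∈ Ioo a2 b2 →
      HasFDerivAt v (0 : E2 →L[ℝ] ℝ) x) :
    ∀ t ∈ Icc a1 b1, ∀ h ∈ Icc a2 b2, v (t, h) = v (a1, a2) := by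
  intro t ht h hh
  rw [hc_const1 h1 h2 hv h0 t ht h hh]
  have hv' : LipschitzOnWith C (v ∘ Prod.swap) (Icc a2 b2 ×ˢ Icc a1 b1) := by
    refine LipschitzOnWith.of_dist_le_mul fun x hx y hy => ?_
    simpa [Prod.dist_eq, max_comm] using hv.dist_le_mul x.swap ⟨hx.2, hx.1⟩ y.swap ⟨hy.2, hy.1⟩
  have h0' : ∀ᵐ x ∂(volume : Measure E2), x.1 ∈ Ioo a2 b2 → x.2 ∈ Ioo a1 b1 →
      HasFDerivAt (v ∘ Prod.swap) (0 : E2 →L[ℝ] ℝ) x := by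
    have mp : MeasurePreserving (Prod.swap : E2 → E2) volume volume :=
      Measure.measurePreserving_swap
    filter_upwards [mp.quasiMeasurePreserving.ae h0] with x hx m1 m2
    have hd : HasFDerivAt (Prod.swap : E2 → E2)
      ((ContinuousLinearMap.snd ℝ ℝ ℝ).prod (ContinuousLinearMap.fst ℝ ℝ ℝ)) x :=
      ((ContinuousLinearMap.snd ℝ ℝ ℝ).prod (ContinuousLinearMap.fst ℝ ℝ ℝ)).hasFDerivAt
    simpa using (hx m2 m1).comp x hd
  have := hc_const1 h2 h1 hv' h0' a2 ⟨le_rfl, h2.le⟩ t ht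
  simpa using this

theorem hc_frame_det {ν : Fin 2 → ℝ} (hν : enorm2 ν = 1) : ν 0 ^ 2 + ν 1 ^ 2 = 1 := by
  have := hν
  unfold enorm2 at this
  rwa [Real.sqrt_eq_one] at this

/-- the frame map -/
noncomputable def hcEll (ν : Fin 2 → ℝ) : E2 →L[ℝ] (Fin 2 → ℝ) :=
  (ContinuousLinearMap.fst ℝ ℝ ℝ).smulRight (perp ν) + (ContinuousLinearMap.snd ℝ ℝ ℝ).smulRight ν

theorem hcEll_apply (ν : Fin 2 → ℝ) (y : E2) : hcEll ν y = y.1 • perp ν + y.2 • ν := rfl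

theorem hc_qmp {ν : Fin 2 → ℝ} (hν : enorm2 ν = 1) (x₀ : Fin 2 → ℝ) {R : ℝ} (hR : 0 < R) :
    Measure.QuasiMeasurePreserving (fun y : E2 => x₀ + R • hcEll ν y) volume volume := by
  have h1 := (volume_preserving_finTwoArrow ℝ).symm
  let Mx : M2 := !![R * (-(ν 1)), R * ν 0; R * ν 0, R * ν 1]
  have hdet : LinearMap.det (Matrix.toLin' Mx) ≠ 0 := by
    rw [LinearMap.det_toLin', Matrix.det_fin_two_of]
    have : R * (-(ν 1)) * (R * ν 1) - R * ν 0 * (R * ν 0) = - (R ^ 2 * (ν 0 ^ 2 + ν 1 ^ 2)) := by ring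
    rw [this, hc_frame_det hν]
    have : 0 < R ^ 2 := by positivity
    linarith
  have h2 := Measure.LinearMap.quasiMeasurePreserving (volume : Measure (Fin 2 → ℝ)) (Matrix.toLin' Mx) hdet
  have h3 := (measurePreserving_add_left (volume : Measure (Fin 2 → ℝ)) x₀).quasiMeasurePreserving
  have := h3.comp (h2.comp h1.quasiMeasurePreserving)
  convert this using 1
  ext y i
  fin_cases i <;> simp [hcEll_apply, Mx, perp, Matrix.mulVec, dotProduct, Fin.sum_univ_two, MeasurableEquiv.finTwoArrow, Matrix.vecHead, Matrix.vecTail] <;> ring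

theorem hc_in_ball {ν : Fin 2 → ℝ} (hν : enorm2 ν = 1) (x₀ : Fin 2 → ℝ) {R r : ℝ} (hR : 0 < R)
    (hRr : R ≤ r / 2) {y : E2} (hy : ‖y‖ ≤ 1) : enorm2 ((x₀ + R • hcEll ν y) - x₀) < r := by
  rw [add_sub_cancel_left]
  unfold enorm2
  rw [Real.sqrt_lt' (by linarith)]
  have e : (R • hcEll ν y) 0 ^ 2 + (R • hcEll ν y) 1 ^ 2 = R ^ 2 * (y.1 ^ 2 + y.2 ^ 2) := by
    have : (R • hcEll ν y) 0 ^ 2 + (R • hcEll ν y) 1 ^ 2 = R ^ 2 * (y.1 ^ 2 + y.2 ^ 2) * (ν 0 ^ 2 + ν 1 ^ 2) := by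
      simp only [hcEll_apply, Pi.smul_apply, Pi.add_apply, smul_eq_mul, perp, Matrix.cons_val_zero,
        Matrix.cons_val_one]
      ring
    rw [this, hc_frame_det hν, mul_one]
  rw [e]
  rw [Prod.norm_def, max_le_iff, Real.norm_eq_abs, Real.norm_eq_abs] at hy
  have h1 := (sq_le_one_iff_abs_le_one _).2 hy.1
  have h2 := (sq_le_one_iff_abs_le_one _).2 hy.2
  have : R ^ 2 * (y.1 ^ 2 + y.2 ^ 2) ≤ R ^ 2 * 2 := by gcongr; linarith
  nlinarith

theorem hc_final (A : M2)
    (ν : Fin 2 → ℝ) (hν : enorm2 ν = 1) (x₀ : Fin 2 → ℝ) (r : ℝ) (hr : 0 < r)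
    (g : ℝ → ℝ) (hg0 : g 0 = 0)
    (hg' : HasDerivAt g 0 0)
    (u : (Fin 2 → ℝ) → Fin 2 → ℝ) (L : NNReal)
    (hu : LipschitzOnWith L u {x : Fin 2 → ℝ | enorm2 (x - x₀) < r})
    (hdiff : ∀ᵐ x ∂(volume : Measure (Fin 2 → ℝ)),
      enorm2 (x - x₀) < r → DifferentiableAt ℝ u x)
    (hU1 : ∀ᵐ x ∂(volume : Measure (Fin 2 → ℝ)),
      (∃ t h' : ℝ, x = x₀ + t • perp ν + h' • ν ∧ h' < g t ∧ enorm2 (x - x₀) < r) →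
        gradMatrix u x = A) (p1 p2 q c : ℝ) (hq : q ≠ 0) (hc : 0 < c)
    (hU2 : ∀ᵐ x ∂(volume : Measure (Fin 2 → ℝ)),
      (∃ t h' : ℝ, x = x₀ + t • perp ν + h' • ν ∧ g t < h' ∧ enorm2 (x - x₀) < r) →
        c ≤ p1 * (gradMatrix u x *ᵥ perp ν - A *ᵥ perp ν) 0
          + p2 * (gradMatrix u x *ᵥ perp ν - A *ᵥ perp ν) 1
          + q * ((gradMatrix u x *ᵥ perp ν - A *ᵥ perp ν) 0 * (gradMatrix u x *ᵥ ν - A *ᵥ ν) 1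
            - (gradMatrix u x *ᵥ ν - A *ᵥ ν) 0 * (gradMatrix u x *ᵥ perp ν - A *ᵥ perp ν) 1)) :
    False := by
  let Al : E2 →L[ℝ] (Fin 2 → ℝ) := (Matrix.toLin' A).toContinuousLinearMap ∘L hcEll ν
  let b0 : ℝ := -p2 / q
  let b1 : ℝ := p1 / q
  let ΛV : ℝ≥0 := L * ‖hcEll ν‖₊ + ‖Al‖₊
  let Λ : ℝ≥0 := (‖q‖₊ + 1) * (ΛV + ‖b0‖₊ + ‖b1‖₊)
  obtain ⟨δ, hδ, hδ2, core⟩ := hc_core Λ hc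
  -- choice of the scale
  have hlo : ∀ᶠ t in 𝓝 (0:ℝ), |g t| ≤ δ * |t| := by
    have := (hasDerivAt_iff_isLittleO.1 hg').def hδ
    simpa [hg0] using this
  obtain ⟨ρ, hρ, hball⟩ := Metric.eventually_nhds_iff.1 hlo
  let R : ℝ := min (ρ / 2) (r / 2)
  have hR : 0 < R := lt_min (by linarith) (by linarith)
  have hRr : R ≤ r / 2 := min_le_right _ _
  have hg1 : ∀ t : ℝ, |t| ≤ 1 → |g (R * t)| ≤ δ * R := by
    intro t ht
    have h1 : |R * t| ≤ R := by
      rw [abs_mul, abs_of_pos hR]; nlinarith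
    have h2 : R < ρ := (min_le_left _ _).trans_lt (by linarith)
    have := hball (y := R * t) (by rw [Real.dist_eq, sub_zero]; linarith)
    exact this.trans (by gcongr)
  let ζ : E2 → (Fin 2 → ℝ) := fun y => x₀ + R • hcEll ν y
  have hζ := hc_qmp hν x₀ hR
  have hζball : ∀ y : E2, ‖y‖ ≤ 1 → enorm2 (ζ y - x₀) < r := fun y hy => hc_in_ball hν x₀ hR hRr hy
  have hζeq : ∀ y : E2, ζ y = x₀ + (R * y.1) • perp ν + (R * y.2) • ν := by
    intro y; simp only [ζ, hcEll_apply, smul_add, smul_smul, add_assoc]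
  let V : E2 → (Fin 2 → ℝ) := fun y => R⁻¹ • u (ζ y) - Al y
  have hVder : ∀ᵐ y ∂(volume : Measure E2), ‖y‖ < 1 →
      HasFDerivAt V ((fderiv ℝ u (ζ y)).comp (hcEll ν) - Al) y := by
    filter_upwards [hζ.ae hdiff] with y hy hn
    have hd := (hy (hζball y hn.le)).hasFDerivAt
    have hz : HasFDerivAt ζ (R • hcEll ν) y := ((hcEll ν).hasFDerivAt.const_smul R).const_add x₀
    have := ((hd.comp y hz).const_smul R⁻¹).sub Al.hasFDerivAt
    refine this.congr_fderiv ?_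
    rw [ContinuousLinearMap.comp_smul, smul_smul, inv_mul_cancel₀ hR.ne', one_smul]
  have hgm : ∀ x v : Fin 2 → ℝ, fderiv ℝ u x v = gradMatrix u x *ᵥ v := by
    intro x v; unfold gradMatrix; rw [LinearMap.toMatrix'_mulVec]; rfl
  have hAl : ∀ y, Al y = A *ᵥ (hcEll ν y) := fun y => rfl
  have hVlip : LipschitzOnWith ΛV V (Metric.closedBall 0 1) := by
    refine LipschitzOnWith.of_dist_le_mul fun y hy z hz => ?_
    rw [mem_closedBall_zero_iff] at hy hz
    have h1 := hu.dist_le_mul _ (hζball y hy) _ (hζball z hz)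
    have h2 : dist (ζ y) (ζ z) ≤ R * (‖hcEll ν‖ * dist y z) := by
      have : ζ y - ζ z = R • hcEll ν (y - z) := by simp only [ζ, map_sub, smul_sub]; abel
      rw [dist_eq_norm, this, norm_smul, Real.norm_eq_abs, abs_of_pos hR, dist_eq_norm]
      gcongr
      exact (hcEll ν).le_opNorm _
    have h3 : ‖Al (y - z)‖ ≤ ‖Al‖ * dist y z := by rw [dist_eq_norm]; exact Al.le_opNorm _
    have e : V y - V z = R⁻¹ • (u (ζ y) - u (ζ z)) - Al (y - z) := by
      simp only [V, map_sub, smul_sub]; abel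
    rw [dist_eq_norm, e]
    calc ‖R⁻¹ • (u (ζ y) - u (ζ z)) - Al (y - z)‖ ≤ ‖R⁻¹ • (u (ζ y) - u (ζ z))‖ + ‖Al (y - z)‖ := norm_sub_le _ _
      _ ≤ R⁻¹ * (L * (R * (‖hcEll ν‖ * dist y z))) + ‖Al‖ * dist y z := by
        rw [norm_smul, Real.norm_eq_abs, abs_of_pos (inv_pos.2 hR), ← dist_eq_norm]
        gcongr
        exact h1.trans (by gcongr)
      _ = ΛV * dist y z := by
        simp only [ΛV, NNReal.coe_add, NNReal.coe_mul, coe_nnnorm]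
        field_simp
  have hbox : ∀ x : E2, ‖x‖ ≤ 1 ↔ x ∈ Icc (-1:ℝ) 1 ×ˢ Icc (-1:ℝ) 1 := by
    intro x
    rw [Prod.norm_def, max_le_iff, Real.norm_eq_abs, Real.norm_eq_abs, abs_le, abs_le]; rfl
  have hsub : Icc (-1:ℝ) 1 ×ˢ Icc (-1:ℝ) (-δ) ⊆ Metric.closedBall (0 : E2) 1 := by
    intro x hx
    rw [mem_closedBall_zero_iff, hbox]
    exact ⟨hx.1, hx.2.1, by linarith [hx.2.2]⟩
  have hViLip : ∀ i, LipschitzOnWith ΛV (fun y => V y i) (Metric.closedBall 0 1) := by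
    intro i
    refine LipschitzOnWith.of_dist_le_mul fun y hy z hz => ?_
    exact (dist_le_pi_dist _ _ i).trans (hVlip.dist_le_mul y hy z hz)
  -- V is constant below
  have hconst : ∀ i, ∀ y ∈ Icc (-1:ℝ) 1 ×ˢ Icc (-1:ℝ) (-δ), V y i = V (-1, -1) i := by
    intro i y hy
    refine hc_const (v := fun y => V y i) (by norm_num) (by linarith) ((hViLip i).mono hsub) ?_ y.1 hy.1 y.2 hy.2
    filter_upwards [hVder, hζ.ae hU1] with y hd hA m1 m2
    have hn : ‖y‖ < 1 := by
      rw [Prod.norm_def, max_lt_iff, Real.norm_eq_abs, Real.norm_eq_abs, abs_lt, abs_lt]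
      exact ⟨m1, m2.1, by linarith [m2.2]⟩
    have hgA : gradMatrix u (ζ y) = A := by
      refine hA ⟨R * y.1, R * y.2, hζeq y, ?_, hζball y hn.le⟩
      have := (abs_le.1 (hg1 y.1 (abs_le.2 ⟨m1.1.le, m1.2.le⟩))).1
      nlinarith [m2.2]
    have h0 : (fderiv ℝ u (ζ y)).comp (hcEll ν) - Al = 0 := by
      refine ContinuousLinearMap.ext fun z => ?_
      simp only [ContinuousLinearMap.sub_apply, ContinuousLinearMap.comp_apply, hgm, hgA, hAl, sub_self,
        ContinuousLinearMap.zero_apply]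
    have := hd hn
    rw [h0] at this
    simpa using hasFDerivAt_pi'.1 this i
  -- the test maps
  let W1 : E2 → ℝ := fun z => q * (V z 0 - V (-1, -1) 0 + max (z.2 + δ) 0 * b0)
  let W2 : E2 → ℝ := fun z => V z 1 - V (-1, -1) 1 + max (z.2 + δ) 0 * b1
  have hmax : ∀ y z : E2, |max (y.2 + δ) 0 - max (z.2 + δ) 0| ≤ dist y z := by
    intro y z
    refine (abs_max_sub_max_le_abs _ _ _).trans ?_
    rw [Prod.dist_eq]
    refine le_max_of_le_right ?_
    rw [Real.dist_eq]; apply le_of_eq; congr 1; ring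
  have hWlip : ∀ i (b : ℝ), ∀ y ∈ Metric.closedBall (0 : E2) 1, ∀ z ∈ Metric.closedBall (0 : E2) 1,
      |(V y i - V (-1, -1) i + max (y.2 + δ) 0 * b) - (V z i - V (-1, -1) i + max (z.2 + δ) 0 * b)|
        ≤ (ΛV + |b|) * dist y z := by
    intro i b y hy z hz
    have h1 := (hViLip i).dist_le_mul y hy z hz
    rw [Real.dist_eq] at h1
    have h2 := hmax y z
    have e : (V y i - V (-1, -1) i + max (y.2 + δ) 0 * b) - (V z i - V (-1, -1) i + max (z.2 + δ) 0 * b)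
      = (V y i - V z i) + (max (y.2 + δ) 0 - max (z.2 + δ) 0) * b := by ring
    rw [e]
    refine (abs_add_le _ _).trans ?_
    rw [abs_mul]
    nlinarith [abs_nonneg b]
  have hW1 : LipschitzOnWith Λ W1 (Metric.closedBall 0 1) := by
    refine LipschitzOnWith.of_dist_le_mul fun y hy z hz => ?_
    have := hWlip 0 b0 y hy z hz
    rw [Real.dist_eq]
    simp only [W1]
    rw [← mul_sub, abs_mul]
    have hd : 0 ≤ dist y z := dist_nonneg
    calc _ ≤ |q| * ((ΛV + |b0|) * dist y z) := by gcongr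
      _ ≤ ((|q| + 1) * (ΛV + |b0| + |b1|)) * dist y z := by
        rw [← mul_assoc]
        exact mul_le_mul_of_nonneg_right (mul_le_mul (by linarith) (by linarith [abs_nonneg b1])
          (by positivity) (by positivity)) hd
      _ = Λ * dist y z := by simp [Λ]
  have hW2 : LipschitzOnWith Λ W2 (Metric.closedBall 0 1) := by
    refine LipschitzOnWith.of_dist_le_mul fun y hy z hz => ?_
    have := hWlip 1 b1 y hy z hz
    rw [Real.dist_eq]
    simp only [W2]
    have hd : 0 ≤ dist y z := dist_nonneg
    calc _ ≤ 1 * (ΛV + |b1|) * dist y z := by rw [one_mul]; exact this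
      _ ≤ ((|q| + 1) * (ΛV + |b0| + |b1|)) * dist y z := by
        exact mul_le_mul_of_nonneg_right (mul_le_mul (by linarith [abs_nonneg q])
          (by linarith [abs_nonneg b0]) (by positivity) (by positivity)) hd
      _ = Λ * dist y z := by simp [Λ]
  -- clamp
  let cl : E2 → E2 := fun y => (max (-1) (min 1 y.1), max (-1) (min 1 y.2))
  have cl_mem : ∀ y, cl y ∈ Metric.closedBall (0 : E2) 1 := by
    intro y
    rw [mem_closedBall_zero_iff, hbox]
    exact ⟨⟨le_max_left _ _, max_le (by norm_num) (min_le_left _ _)⟩,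
      ⟨le_max_left _ _, max_le (by norm_num) (min_le_left _ _)⟩⟩
  have cl_lip : LipschitzWith 1 cl := by
    have h1 : LipschitzWith 1 (fun t : ℝ => max (-1) (min 1 t)) :=
      (LipschitzWith.id.const_min 1).const_max (-1)
    have := (h1.comp LipschitzWith.prod_fst).prodMk (h1.comp (LipschitzWith.prod_snd (α := ℝ) (β := ℝ)))
    simpa using this
  have cl_id : ∀ y : E2, ‖y‖ ≤ 1 → cl y = y := by
    intro y hy
    rw [hbox] at hy
    ext
    · simp only [cl]; rw [min_eq_right hy.1.2, max_eq_right hy.1.1]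
    · simp only [cl]; rw [min_eq_right hy.2.2, max_eq_right hy.2.1]
  obtain ⟨M1, hM1⟩ := (isCompact_closedBall (0 : E2) 1).exists_bound_of_continuousOn hW1.continuousOn
  obtain ⟨M2', hM2⟩ := (isCompact_closedBall (0 : E2) 1).exists_bound_of_continuousOn hW2.continuousOn
  have cl_neg : ∀ y : E2, y.2 ≤ -δ → cl y ∈ Icc (-1:ℝ) 1 ×ˢ Icc (-1:ℝ) (-δ) := by
    intro y hy
    refine ⟨⟨le_max_left _ _, max_le (by norm_num) (min_le_left _ _)⟩,
      ⟨le_max_left _ _, max_le (by linarith) ((min_le_right _ _).trans hy)⟩⟩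
  refine core (W1 ∘ cl) (W2 ∘ cl) (max M1 M2') ?_ ?_ ?_ ?_ ?_ ?_ ?_
  · have := hW1.comp (lipschitzOnWith_univ.2 cl_lip) (fun x _ => cl_mem x)
    simpa using this
  · have := hW2.comp (lipschitzOnWith_univ.2 cl_lip) (fun x _ => cl_mem x)
    simpa using this
  · intro x; exact le_max_of_le_left (hM1 _ (cl_mem x))
  · intro x; exact le_max_of_le_right (hM2 _ (cl_mem x))
  · intro x hx
    have hm := cl_neg x hx
    simp only [Function.comp_apply, W1]
    rw [hconst 0 _ hm, max_eq_right (by linarith [hm.2.2])]; simp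
  · intro x hx
    have hm := cl_neg x hx
    simp only [Function.comp_apply, W2]
    rw [hconst 1 _ hm, max_eq_right (by linarith [hm.2.2])]; simp
  · filter_upwards [hVder, hζ.ae hU2] with y hd hin hn hy
    have hin' := hin ⟨R * y.1, R * y.2, hζeq y, ?_, hζball y hn.le⟩
    swap
    · have hn' := (hbox y).1 hn.le
      have := (abs_le.1 (hg1 y.1 (abs_le.2 hn'.1))).2
      nlinarith
    have hd' := hd hn
    have hnear : ∀ᶠ z in 𝓝 y, ‖z‖ < 1 ∧ -δ < z.2 := by
      refine ((isOpen_lt continuous_norm continuous_const).inter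
        (isOpen_lt continuous_const continuous_snd)).mem_nhds ⟨hn, ?_⟩
      show -δ < y.2
      linarith
    have e1 : W1 ∘ cl =ᶠ[𝓝 y] fun z => q * (V z 0 - V (-1, -1) 0 + (z.2 + δ) * b0) := by
      filter_upwards [hnear] with z hz
      simp only [Function.comp_apply, cl_id z hz.1.le, W1]
      rw [max_eq_left (by linarith [hz.2])]
    have e2 : W2 ∘ cl =ᶠ[𝓝 y] fun z => V z 1 - V (-1, -1) 1 + (z.2 + δ) * b1 := by
      filter_upwards [hnear] with z hz
      simp only [Function.comp_apply, cl_id z hz.1.le, W2]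
      rw [max_eq_left (by linarith [hz.2])]
    have hp := hasFDerivAt_pi'.1 hd'
    have hs : HasFDerivAt (fun z : E2 => z.2) (ContinuousLinearMap.snd ℝ ℝ ℝ) y := hasFDerivAt_snd
    have f1 := ((((hp 0).sub_const (V (-1, -1) 0)).add ((hs.add_const δ).mul_const b0)).const_mul q).congr_of_eventuallyEq e1
    have f2 := (((hp 1).sub_const (V (-1, -1) 1)).add ((hs.add_const δ).mul_const b1)).congr_of_eventuallyEq e2
    rw [(f1.hasLineDerivAt (1,0)).lineDeriv, (f1.hasLineDerivAt (0,1)).lineDeriv,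
      (f2.hasLineDerivAt (1,0)).lineDeriv, (f2.hasLineDerivAt (0,1)).lineDeriv]
    have ev1 : hcEll ν (1,0) = perp ν := by simp [hcEll_apply]
    have ev2 : hcEll ν (0,1) = ν := by simp [hcEll_apply]
    have hq1 : q * b1 = p1 := by simp only [b1]; field_simp
    have hq0 : q * b0 = -p2 := by simp only [b0]; field_simp
    refine hin'.trans (le_of_eq ?_)
    simp only [ContinuousLinearMap.smul_apply, ContinuousLinearMap.add_apply, ContinuousLinearMap.comp_apply,
      ContinuousLinearMap.proj_apply, ContinuousLinearMap.sub_apply, hgm, hAl, ev1, ev2,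
      ContinuousLinearMap.coe_snd', smul_eq_mul, mul_zero, mul_one, add_zero]
    change _ = q * ((gradMatrix u (ζ y) *ᵥ perp ν - A *ᵥ perp ν) 0) * ((gradMatrix u (ζ y) *ᵥ ν - A *ᵥ ν) 1 + b1) - q * ((gradMatrix u (ζ y) *ᵥ ν - A *ᵥ ν) 0 + b0) * (gradMatrix u (ζ y) *ᵥ perp ν - A *ᵥ perp ν) 1
    rw [← hq1, show p2 = -(q * b0) by linarith]
    ring
open Matrix Real Set MeasureTheory
open scoped Topology NNReal ENNReal

theorem hc_cont_aux (g : (Fin 2 → Fin 2 → ℝ) × ℝ → ℝ) (hg : ConvexOn ℝ Set.univ g) :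
    Continuous g := by
  have := hg.continuousOn_interior
  simpa [continuousOn_univ] using this

theorem hc_cont (g : M2 × ℝ → ℝ) (hg : ConvexOn ℝ Set.univ g) : Continuous g :=
  hc_cont_aux g hg

theorem hc_hull (B B' : Set M2) (hBB : B' ⊆ B) (F : M2)
    (hF : (F, F.det) ∈ closure (convexHull ℝ ((fun G : M2 => (G, G.det)) '' B'))) : F ∈ pcHull B := by
  rintro h ⟨g, hg, hgh⟩ c hc
  have hcont := hc_cont g hg
  rw [hgh]
  have hcl : IsClosed {x | g x ≤ c} := isClosed_le hcont continuous_const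
  refine closure_minimal (convexHull_min ?_ ?_) hcl hF
  · rintro _ ⟨G, hG, rfl⟩
    show g (G, G.det) ≤ c
    rw [← hgh]; exact hc G (hBB hG)
  · simpa using hg.convex_le c

theorem hc_compact (B' : Set M2) (L : ℝ) (hB' : ∀ F ∈ B', ∀ i j, |F i j| ≤ L) :
    IsCompact (closure (convexHull ℝ ((fun G : M2 => (G, G.det)) '' B'))) := by
  have hK : IsCompact ((Set.univ.pi fun _ : Fin 2 => Set.univ.pi fun _ : Fin 2 => Icc (-L) L : Set (Fin 2 → Fin 2 → ℝ)) ×ˢ (Icc (-(2 * L ^ 2)) (2 * L ^ 2) : Set ℝ)) :=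
    (isCompact_univ_pi fun _ => isCompact_univ_pi fun _ => isCompact_Icc).prod isCompact_Icc
  have hKc : Convex ℝ ((Set.univ.pi fun _ : Fin 2 => Set.univ.pi fun _ : Fin 2 => Icc (-L) L : Set (Fin 2 → Fin 2 → ℝ)) ×ˢ (Icc (-(2 * L ^ 2)) (2 * L ^ 2) : Set ℝ)) :=
    (convex_pi fun _ _ => convex_pi fun _ _ => convex_Icc _ _).prod (convex_Icc _ _)
  refine hK.of_isClosed_subset isClosed_closure (closure_minimal (convexHull_min ?_ hKc) hK.isClosed)
  rintro _ ⟨F, hF, rfl⟩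
  have hb := hB' F hF
  refine ⟨fun i _ j _ => abs_le.1 (hb i j), abs_le.1 ?_⟩
  show |F.det| ≤ _
  rw [Matrix.det_fin_two]
  have hL : 0 ≤ L := (abs_nonneg _).trans (hb 0 0)
  have h1 : |F 0 0 * F 1 1| ≤ L * L := by
    rw [abs_mul]; exact mul_le_mul (hb _ _) (hb _ _) (abs_nonneg _) hL
  have h2 : |F 0 1 * F 1 0| ≤ L * L := by
    rw [abs_mul]; exact mul_le_mul (hb _ _) (hb _ _) (abs_nonneg _) hL
  refine (abs_sub _ _).trans ?_
  nlinarith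

/-- the affine map of minors relative to `A` -/
def hcP (A : M2) (ν : Fin 2 → ℝ) (x : M2 × ℝ) : ℝ × ℝ × ℝ :=
  ((x.1 0 0 - A 0 0) * (-(ν 1)) + (x.1 0 1 - A 0 1) * ν 0,
    (x.1 1 0 - A 1 0) * (-(ν 1)) + (x.1 1 1 - A 1 1) * ν 0,
    -(x.2 - (A 0 0 * x.1 1 1 + A 1 1 * x.1 0 0 - A 0 1 * x.1 1 0 - A 1 0 * x.1 0 1)
      + (A 0 0 * A 1 1 - A 0 1 * A 1 0)))

theorem hcP_cont (A : M2) (ν : Fin 2 → ℝ) : Continuous (hcP A ν) := by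
  have h : ∀ i j, Continuous fun x : M2 × ℝ => x.1 i j := fun i j =>
    continuous_fst.matrix_elem i j
  have h00 := h 0 0
  have h01 := h 0 1
  have h10 := h 1 0
  have h11 := h 1 1
  unfold hcP
  fun_prop

theorem hcP_convex (A : M2) (ν : Fin 2 → ℝ) {C : Set (M2 × ℝ)} (hC : Convex ℝ C) :
    Convex ℝ (hcP A ν '' C) := by
  rintro _ ⟨x, hx, rfl⟩ _ ⟨y, hy, rfl⟩ a b ha hb hab
  refine ⟨a • x + b • y, hC hx hy ha hb hab, ?_⟩
  have : b = 1 - a := by linarith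
  subst this
  simp only [hcP, Prod.fst_add, Prod.snd_add, Prod.smul_fst, Prod.smul_snd, Matrix.add_apply,
    Matrix.smul_apply, smul_eq_mul, Prod.smul_mk, Prod.mk_add_mk, Prod.mk.injEq]
  refine ⟨by ring, by ring, by ring⟩

theorem hcP_grad {A : M2} {ν : Fin 2 → ℝ} (hν : enorm2 ν = 1) (F : M2) :
    hcP A ν (F, F.det) = ((F *ᵥ perp ν - A *ᵥ perp ν) 0, (F *ᵥ perp ν - A *ᵥ perp ν) 1,
      (F *ᵥ perp ν - A *ᵥ perp ν) 0 * (F *ᵥ ν - A *ᵥ ν) 1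
            - (F *ᵥ ν - A *ᵥ ν) 0 * (F *ᵥ perp ν - A *ᵥ perp ν) 1) := by
  have h := hc_frame_det hν
  simp only [hcP, Matrix.mulVec, dotProduct, Fin.sum_univ_two, perp, Pi.sub_apply,
    Matrix.cons_val_zero, Matrix.cons_val_one, Matrix.det_fin_two, Prod.mk.injEq]
  refine ⟨by ring, by ring, ?_⟩
  linear_combination (-(F 0 0 * F 1 1 - F 0 1 * F 1 0 - (A 0 0 * F 1 1 + A 1 1 * F 0 0 - A 0 1 * F 1 0 - A 1 0 * F 0 1)
      + (A 0 0 * A 1 1 - A 0 1 * A 1 0))) * (-h)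

theorem hcP_zero {A : M2} {ν : Fin 2 → ℝ} (hν : enorm2 ν = 1) (x : M2 × ℝ) (hx : hcP A ν x = 0) :
    ∃ a : Fin 2 → ℝ, A + vecMulVec a ν = x.1 ∧ x.2 = x.1.det := by
  have h := hc_frame_det hν
  obtain ⟨F, d⟩ := x
  simp only [hcP, Prod.mk_eq_zero] at hx
  obtain ⟨h1, h2, h3⟩ := hx
  refine ⟨(F - A) *ᵥ ν, ?_, ?_⟩
  · ext i j
    rw [Matrix.add_apply, vecMulVec_apply]
    simp only [Matrix.mulVec, dotProduct, Fin.sum_univ_two, Matrix.sub_apply]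
    fin_cases i <;> fin_cases j <;> simp only [Fin.zero_eta, Fin.mk_one, Fin.isValue]
    · linear_combination (F 0 0 - A 0 0) * h + ν 1 * h1
    · linear_combination (F 0 1 - A 0 1) * h - ν 0 * h1
    · linear_combination (F 1 0 - A 1 0) * h + ν 1 * h2
    · linear_combination (F 1 1 - A 1 1) * h - ν 0 * h2
  · rw [Matrix.det_fin_two]
    simp only
    have e1 : F 0 0 - A 0 0 = ν 0 * ((F 0 0 - A 0 0) * ν 0 + (F 0 1 - A 0 1) * ν 1) := by
      linear_combination -(F 0 0 - A 0 0) * h - ν 1 * h1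
    have e2 : F 0 1 - A 0 1 = ν 1 * ((F 0 0 - A 0 0) * ν 0 + (F 0 1 - A 0 1) * ν 1) := by
      linear_combination -(F 0 1 - A 0 1) * h + ν 0 * h1
    have e3 : F 1 0 - A 1 0 = ν 0 * ((F 1 0 - A 1 0) * ν 0 + (F 1 1 - A 1 1) * ν 1) := by
      linear_combination -(F 1 0 - A 1 0) * h - ν 1 * h2
    have e4 : F 1 1 - A 1 1 = ν 1 * ((F 1 0 - A 1 0) * ν 0 + (F 1 1 - A 1 1) * ν 1) := by
      linear_combination -(F 1 1 - A 1 1) * h + ν 0 * h2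
    have e5 : (F 0 0 - A 0 0) * (F 1 1 - A 1 1) = (F 0 1 - A 0 1) * (F 1 0 - A 1 0) := by
      generalize (F 0 0 - A 0 0) * ν 0 + (F 0 1 - A 0 1) * ν 1 = k at e1 e2
      generalize (F 1 0 - A 1 0) * ν 0 + (F 1 1 - A 1 1) * ν 1 = m at e3 e4
      rw [e1, e2, e3, e4]; ring
    linear_combination -h3 - e5

theorem hc_bound (x₀ : Fin 2 → ℝ) (r : ℝ)
    (u : (Fin 2 → ℝ) → Fin 2 → ℝ) (L : NNReal)
    (hu : LipschitzOnWith L u {x : Fin 2 → ℝ | enorm2 (x - x₀) < r}) (x : Fin 2 → ℝ)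
    (hx : enorm2 (x - x₀) < r) (i j : Fin 2) : |gradMatrix u x i j| ≤ L := by
  have ho : IsOpen {x : Fin 2 → ℝ | enorm2 (x - x₀) < r} := by
    refine isOpen_lt ?_ continuous_const
    unfold enorm2
    fun_prop
  have h1 := norm_fderiv_le_of_lipschitzOn ℝ (ho.mem_nhds hx) hu
  have h2 : gradMatrix u x i j = fderiv ℝ u x (Pi.single j 1) i := by
    unfold gradMatrix
    rw [LinearMap.toMatrix'_apply]
    simp
  rw [h2, ← Real.norm_eq_abs]
  refine (norm_le_pi_norm _ i).trans ((ContinuousLinearMap.le_of_opNorm_le _ h1 _).trans ?_)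
  have : ‖(Pi.single j 1 : Fin 2 → ℝ)‖ ≤ 1 := by simp [Pi.norm_single]
  nlinarith [L.2]

/-- Generalized Hadamard jump condition for curved (Lipschitz-graph) interfaces:
if Du = A a.e. below the graph of g and Du ∈ 𝓑 a.e. above it, then A is
ν-compatible with the polyconvex hull 𝓑^{pc}. -/
theorem stmt19 (B : Set M2) (hB : IsClosed B) (A : M2)
    (ν : Fin 2 → ℝ) (hν : enorm2 ν = 1) (x₀ : Fin 2 → ℝ) (r : ℝ) (hr : 0 < r)
    (g : ℝ → ℝ) (Kg : NNReal) (hg : LipschitzWith Kg g) (hg0 : g 0 = 0)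
    (hg' : HasDerivAt g 0 0)
    (u : (Fin 2 → ℝ) → Fin 2 → ℝ) (L : NNReal)
    (hu : LipschitzOnWith L u {x : Fin 2 → ℝ | enorm2 (x - x₀) < r})
    (hdiff : ∀ᵐ x ∂(volume : Measure (Fin 2 → ℝ)),
      enorm2 (x - x₀) < r → DifferentiableAt ℝ u x)
    (hU1 : ∀ᵐ x ∂(volume : Measure (Fin 2 → ℝ)),
      (∃ t h' : ℝ, x = x₀ + t • perp ν + h' • ν ∧ h' < g t ∧ enorm2 (x - x₀) < r) →
        gradMatrix u x = A)
    (hU2 : ∀ᵐ x ∂(volume : Measure (Fin 2 → ℝ)),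
      (∃ t h' : ℝ, x = x₀ + t • perp ν + h' • ν ∧ g t < h' ∧ enorm2 (x - x₀) < r) →
        gradMatrix u x ∈ B) :
    ∃ a : Fin 2 → ℝ, A + vecMulVec a ν ∈ pcHull B := by
  let B' : Set M2 := {F | F ∈ B ∧ ∀ i j, |F i j| ≤ L}
  let C := closure (convexHull ℝ ((fun G : M2 => (G, G.det)) '' B'))
  have hC : IsCompact C := hc_compact B' L fun F hF => hF.2
  have hCc : Convex ℝ C := (convex_convexHull ℝ _).closure
  have hK : IsCompact (hcP A ν '' C) := hC.image (hcP_cont A ν)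
  have hKc : Convex ℝ (hcP A ν '' C) := hcP_convex A ν hCc
  by_cases h0 : (0 : ℝ × ℝ × ℝ) ∈ hcP A ν '' C
  · obtain ⟨x, hx, hx0⟩ := h0
    obtain ⟨a, ha, hd⟩ := hcP_zero hν x hx0
    refine ⟨a, hc_hull B B' (fun F hF => hF.1) _ ?_⟩
    rw [ha, ← hd]
    exact hx
  exfalso
  obtain ⟨f, s, hs, hfs⟩ := geometric_hahn_banach_point_closed hKc hK.isClosed h0
  rw [map_zero] at hs
  obtain ⟨M, hM⟩ := hK.isBounded.exists_norm_le
  have hf : ∀ x y z : ℝ, f (x, y, z) = f (1, 0, 0) * x + f (0, 1, 0) * y + f (0, 0, 1) * z := by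
    intro x y z
    have : ((x, y, z) : ℝ × ℝ × ℝ) = x • (1, 0, 0) + y • (0, 1, 0) + z • (0, 0, 1) := by simp
    rw [this, map_add, map_add, map_smul, map_smul, map_smul]
    simp only [smul_eq_mul]; ring
  obtain ⟨q, hq, hqs⟩ : ∃ q : ℝ, q ≠ 0 ∧ |q - f (0, 0, 1)| * (|M| + 1) ≤ s / 2 := by
    by_cases h : f (0, 0, 1) = 0
    · have hp : 0 < s / 2 / (|M| + 1) := by positivity
      refine ⟨s / 2 / (|M| + 1), hp.ne', ?_⟩
      rw [h, sub_zero, abs_of_pos hp]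
      exact (div_mul_cancel₀ _ (by positivity)).le
    · exact ⟨f (0, 0, 1), h, by simp; linarith⟩
  refine hc_final A ν hν x₀ r hr g hg0 hg' u L hu hdiff hU1 (f (1, 0, 0)) (f (0, 1, 0)) q (s / 2) hq
    (by linarith) ?_
  filter_upwards [hU2] with x hx hm
  have hball : enorm2 (x - x₀) < r := by
    obtain ⟨t, h', -, -, h⟩ := hm
    exact h
  have hmem : gradMatrix u x ∈ B' := ⟨hx hm, hc_bound x₀ r u L hu x hball⟩
  have hPm : hcP A ν (gradMatrix u x, (gradMatrix u x).det) ∈ hcP A ν '' C :=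
    ⟨_, subset_closure (subset_convexHull ℝ _ ⟨_, hmem, rfl⟩), rfl⟩
  have h1 := hfs _ hPm
  have h2 := hM _ hPm
  rw [hcP_grad hν] at h1 h2
  rw [hf] at h1
  generalize (gradMatrix u x *ᵥ perp ν - A *ᵥ perp ν) 0 = y0 at *
  generalize (gradMatrix u x *ᵥ perp ν - A *ᵥ perp ν) 1 = y1 at *
  generalize (y0 * (gradMatrix u x *ᵥ ν - A *ᵥ ν) 1 - (gradMatrix u x *ᵥ ν - A *ᵥ ν) 0 * y1) = y2 at *
  have h3 : |y2| ≤ |M| + 1 := by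
    have := ((norm_snd_le (y1, y2)).trans (norm_snd_le (y0, y1, y2))).trans h2
    rw [Real.norm_eq_abs] at this
    linarith [le_abs_self M]
  have h4 : |(q - f (0, 0, 1)) * y2| ≤ s / 2 := by
    rw [abs_mul]
    exact (mul_le_mul_of_nonneg_left h3 (abs_nonneg _)).trans hqs
  have h5 := (abs_le.1 h4).1
  nlinarith
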